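/- Let n ≥ 1 and let w be a permutation of {1,…,2n}. In ℤ[Y₁,…,Y_n] set P₁_w := 2^{n−1} · ( ∏_{i=1}^{n} ρ(w(i)) + ∏_{i=1}^{n} Y_i ) · ∏_{1≤i<j≤n} (ρ(w(i)) + ρ(w(j)))·(ρ(w(i)) + ρ(w(2n+1−j))). Then: if w is signed with an even number of sign changes, P₁_w = (−1)^{inv(|w|)} · 2^n · Y₁⋯Y_n · ∏_{1≤i<j≤n} (Y_i + Y_j)(Y_i − Y_j); in all other cases (w signed with an odd number of sign changes, or w not signed), P₁_w = 0. -/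

import Mathlib

/-!
Statement 2: restriction property of the polynomial `P₁` representing the equivariant
class of the first closed `SO(2n)`-orbit.  We work 0-indexed: positions `0,…,2n−1`
correspond to `1,…,2n`; the 1-based `2n+1−i` is position `2n−1−i`.
-/

/-- The variable `Y_k` of `ℤ[Y₁,…,Yₙ]` (0-indexed), or `0` if `k` is out of range. -/
noncomputable def Yv (n : ℕ) (k : ℕ) : MvPolynomial (Fin n) ℤ :=
  if h : k < n then MvPolynomial.X ⟨k, h⟩ else 0

/-- `ρ` in the even case (0-indexed): `ρ(k) = Y_k` for `k < n`, `ρ(k) = −Y_{2n−1−k}`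
for `k ≥ n`. -/
noncomputable def rhoEven (n : ℕ) (k : ℕ) : MvPolynomial (Fin n) ℤ :=
  if k < n then Yv n k else - Yv n (2 * n - 1 - k)

/-- `w` is a signed permutation: `w(2n+1−i) = 2n+1−w(i)` for all `i`
(0-indexed: `w(2n−1−k) = 2n−1−w(k)`). -/
def SignedEven (n : ℕ) (w : Equiv.Perm (Fin (2 * n))) : Prop :=
  ∀ k : Fin (2 * n), ((w ⟨2 * n - 1 - (k : ℕ), by omega⟩ : Fin (2 * n)) : ℕ)
    = 2 * n - 1 - ((w k : Fin (2 * n)) : ℕ)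

/-- The number of sign changes of `w`: the number of `i ∈ {1,…,n}` with `w(i) > n`. -/
def signChanges (n : ℕ) (w : Equiv.Perm (Fin (2 * n))) : ℕ :=
  (Finset.univ.filter fun i : Fin n =>
    n ≤ ((w ⟨(i : ℕ), by omega⟩ : Fin (2 * n)) : ℕ)).card

/-- The "absolute value" `|w|(i)`: `w(i)` if `w(i) ≤ n` (1-based), else `2n+1−w(i)`. -/
def absEven (n : ℕ) (w : Equiv.Perm (Fin (2 * n))) (i : Fin n) : ℕ :=
  if ((w ⟨(i : ℕ), by omega⟩ : Fin (2 * n)) : ℕ) < n then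
    ((w ⟨(i : ℕ), by omega⟩ : Fin (2 * n)) : ℕ)
  else 2 * n - 1 - ((w ⟨(i : ℕ), by omega⟩ : Fin (2 * n)) : ℕ)

/-- The number of inversions of `|w|`: pairs `i < j` with `|w|(i) > |w|(j)`. -/
def invEven (n : ℕ) (w : Equiv.Perm (Fin (2 * n))) : ℕ :=
  (Finset.univ.filter fun p : Fin n × Fin n =>
    p.1 < p.2 ∧ absEven n w p.2 < absEven n w p.1).card

/-- `∏_{1≤i<j≤n} (ρ(w(i))+ρ(w(j)))·(ρ(w(i))+ρ(w(2n+1−j)))`. -/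
noncomputable def pairProdEven (n : ℕ) (w : Equiv.Perm (Fin (2 * n))) :
    MvPolynomial (Fin n) ℤ :=
  ∏ p ∈ Finset.univ.filter (fun p : Fin n × Fin n => p.1 < p.2),
    (rhoEven n ((w ⟨(p.1 : ℕ), by omega⟩ : Fin (2 * n)) : ℕ) +
        rhoEven n ((w ⟨(p.2 : ℕ), by omega⟩ : Fin (2 * n)) : ℕ)) *
    (rhoEven n ((w ⟨(p.1 : ℕ), by omega⟩ : Fin (2 * n)) : ℕ) +
        rhoEven n ((w ⟨2 * n - 1 - (p.2 : ℕ), by omega⟩ : Fin (2 * n)) : ℕ))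

/-- `P₁_w = 2^{n−1}·(∏_{i=1}^n ρ(w(i)) + Y₁⋯Yₙ)·∏_{1≤i<j≤n}(ρ(w(i))+ρ(w(j)))(ρ(w(i))+ρ(w(2n+1−j)))`. -/
noncomputable def P1Even (n : ℕ) (w : Equiv.Perm (Fin (2 * n))) :
    MvPolynomial (Fin n) ℤ :=
  2 ^ (n - 1) *
    ((∏ i : Fin n, rhoEven n ((w ⟨(i : ℕ), by omega⟩ : Fin (2 * n)) : ℕ)) +
      ∏ i : Fin n, MvPolynomial.X i) *
    pairProdEven n w

theorem Finset.prod_filter_fst_lt_snd {n : ℕ} {M : Type*} [CommMonoid M]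
    (f : Fin n → Fin n → M) :
    ∏ p ∈ Finset.univ.filter (fun p : Fin n × Fin n => p.1 < p.2), f p.1 p.2 =
      ∏ i, ∏ j ∈ Finset.Ioi i, f i j := by
  rw [Finset.prod_filter, Fintype.prod_prod_type]
  refine Finset.prod_congr rfl fun i _ => ?_
  rw [← Finset.prod_filter]
  exact Finset.prod_congr (by ext; simp) fun _ _ => rfl

theorem Equiv.Perm.sign_eq_neg_one_pow_card_inversions {n : ℕ} (σ : Equiv.Perm (Fin n)) :
    σ.sign = (-1) ^ (Finset.univ.filter fun p : Fin n × Fin n =>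
      p.1 < p.2 ∧ σ p.2 < σ p.1).card := by
  rw [σ.sign_eq_prod_prod_Ioi,
    ← Finset.prod_filter_fst_lt_snd fun i j => if σ i < σ j then (1 : ℤˣ) else -1,
    Finset.prod_ite, Finset.prod_const_one, one_mul, Finset.prod_const, Finset.filter_filter]
  congr 2
  ext p
  simp only [Finset.mem_filter, Finset.mem_univ, true_and, not_lt]
  refine and_congr_right fun h => ⟨fun h' => h'.lt_of_ne fun e => ?_, le_of_lt⟩
  exact h.ne' (σ.injective e)

theorem rhoEven_reflect {n k : ℕ} (hk : k < 2 * n) :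
    rhoEven n (2 * n - 1 - k) = -rhoEven n k := by
  unfold rhoEven
  by_cases h : k < n
  · rw [if_neg (by omega), if_pos h, show 2 * n - 1 - (2 * n - 1 - k) = k by omega]
  · rw [if_pos (by omega), if_neg h, neg_neg]

theorem absEven_lt (n : ℕ) (w : Equiv.Perm (Fin (2 * n))) (i : Fin n) : absEven n w i < n := by
  unfold absEven
  split_ifs <;> omega

theorem rhoEven_apply_eq (n : ℕ) (w : Equiv.Perm (Fin (2 * n))) (i : Fin n) :
    rhoEven n (w ⟨(i : ℕ), by omega⟩ : Fin (2 * n)) =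
      (if n ≤ ((w ⟨(i : ℕ), by omega⟩ : Fin (2 * n)) : ℕ) then -1 else 1) *
        MvPolynomial.X ⟨absEven n w i, absEven_lt n w i⟩ := by
  have hlt := absEven_lt n w i
  unfold absEven at hlt
  unfold rhoEven Yv
  by_cases h : ((w ⟨(i : ℕ), by omega⟩ : Fin (2 * n)) : ℕ) < n
  · simp [h, absEven]
  · rw [if_neg h] at hlt
    simp [h, absEven, hlt, not_lt.mp h]

theorem SignedEven.absEven_injective {n : ℕ} {w : Equiv.Perm (Fin (2 * n))}
    (hw : SignedEven n w) : Function.Injective (absEven n w) := by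
  intro i j hij
  have key : w ⟨i, by omega⟩ = w ⟨j, by omega⟩ ∨
      w ⟨i, by omega⟩ = w ⟨2 * n - 1 - j, by omega⟩ := by
    have hj := hw ⟨j, by omega⟩
    simp only [Fin.ext_iff]
    simp only at hj
    rw [hj]
    unfold absEven at hij
    split_ifs at hij <;> omega
  rcases key with h | h <;> have := congrArg Fin.val (w.injective h) <;> simp only at this
  · exact Fin.ext this
  · omega

/-- The permutation `|w|` of a signed permutation `w`. -/
noncomputable def SignedEven.absPerm {n : ℕ} {w : Equiv.Perm (Fin (2 * n))}
    (hw : SignedEven n w) : Equiv.Perm (Fin n) :=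
  Equiv.ofBijective (fun i => ⟨absEven n w i, absEven_lt n w i⟩) <|
    Finite.injective_iff_bijective.mp fun _ _ h => hw.absEven_injective (congrArg Fin.val h)

theorem SignedEven.sign_absPerm {n : ℕ} {w : Equiv.Perm (Fin (2 * n))} (hw : SignedEven n w) :
    hw.absPerm.sign = (-1) ^ invEven n w :=
  hw.absPerm.sign_eq_neg_one_pow_card_inversions

theorem SignedEven.prod_rhoEven {n : ℕ} {w : Equiv.Perm (Fin (2 * n))} (hw : SignedEven n w) :
    ∏ i : Fin n, rhoEven n ((w ⟨(i : ℕ), by omega⟩ : Fin (2 * n)) : ℕ) =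
      (-1) ^ signChanges n w * ∏ i : Fin n, MvPolynomial.X i := by
  simp_rw [rhoEven_apply_eq]
  rw [Finset.prod_mul_distrib, Finset.prod_ite, Finset.prod_const_one, mul_one, Finset.prod_const]
  exact congrArg _ (Equiv.prod_comp hw.absPerm MvPolynomial.X)

theorem SignedEven.pairProdEven_eq {n : ℕ} {w : Equiv.Perm (Fin (2 * n))} (hw : SignedEven n w) :
    pairProdEven n w = (-1) ^ invEven n w *
      ∏ p ∈ Finset.univ.filter (fun p : Fin n × Fin n => p.1 < p.2),
        (MvPolynomial.X p.1 + MvPolynomial.X p.2) * (MvPolynomial.X p.1 - MvPolynomial.X p.2) := by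
  have factor (p : Fin n × Fin n) :
      (rhoEven n ((w ⟨(p.1 : ℕ), by omega⟩ : Fin (2 * n)) : ℕ) +
          rhoEven n ((w ⟨(p.2 : ℕ), by omega⟩ : Fin (2 * n)) : ℕ)) *
        (rhoEven n ((w ⟨(p.1 : ℕ), by omega⟩ : Fin (2 * n)) : ℕ) +
          rhoEven n ((w ⟨2 * n - 1 - (p.2 : ℕ), by omega⟩ : Fin (2 * n)) : ℕ)) =
      (MvPolynomial.X (hw.absPerm p.1) + MvPolynomial.X (hw.absPerm p.2)) *
        (MvPolynomial.X (hw.absPerm p.1) - MvPolynomial.X (hw.absPerm p.2)) := by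
    have hp := hw ⟨p.2, by omega⟩
    simp only at hp
    rw [hp, rhoEven_reflect (Fin.is_lt _), rhoEven_apply_eq, rhoEven_apply_eq]
    simp only [SignedEven.absPerm, Equiv.ofBijective_apply]
    split_ifs <;> ring
  have anti (i j : Fin n) : ((MvPolynomial.X i + MvPolynomial.X j) *
      (MvPolynomial.X i - MvPolynomial.X j) : MvPolynomial (Fin n) ℤ) =
        -((MvPolynomial.X j + MvPolynomial.X i) * (MvPolynomial.X j - MvPolynomial.X i)) := by
    ring
  have hprod := hw.absPerm.prod_Ioi_comp_eq_sign_mul_prod anti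
  rw [← Finset.prod_filter_fst_lt_snd fun i j => ((MvPolynomial.X (hw.absPerm i) +
      MvPolynomial.X (hw.absPerm j)) * (MvPolynomial.X (hw.absPerm i) -
        MvPolynomial.X (hw.absPerm j)) : MvPolynomial (Fin n) ℤ),
    ← Finset.prod_filter_fst_lt_snd fun i j => ((MvPolynomial.X i + MvPolynomial.X j) *
      (MvPolynomial.X i - MvPolynomial.X j) : MvPolynomial (Fin n) ℤ), hw.sign_absPerm] at hprod
  unfold pairProdEven
  rw [Finset.prod_congr rfl fun p _ => factor p, hprod]
  push_cast
  rfl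

theorem pairProdEven_eq_zero {n : ℕ} {w : Equiv.Perm (Fin (2 * n))} (hw : ¬SignedEven n w) :
    pairProdEven n w = 0 := by
  classical
  have hex : ∃ i, ∃ h : i < n, ((w ⟨2 * n - 1 - i, by omega⟩ : Fin (2 * n)) : ℕ) ≠
      2 * n - 1 - ((w ⟨i, by omega⟩ : Fin (2 * n)) : ℕ) := by
    by_contra! hall
    refine hw fun k => ?_
    by_cases hk : (k : ℕ) < n
    · exact hall k hk
    · have h := hall (2 * n - 1 - k) (by omega)
      have e : (⟨2 * n - 1 - (2 * n - 1 - k), by omega⟩ : Fin (2 * n)) = k := Fin.ext (by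
        simp only; omega)
      rw [e] at h
      omega
  obtain ⟨hi, hne⟩ := Nat.find_spec hex
  have hmin {j : ℕ} (hj : j < Nat.find hex) :
      ((w ⟨2 * n - 1 - j, by omega⟩ : Fin (2 * n)) : ℕ) =
        2 * n - 1 - ((w ⟨j, by omega⟩ : Fin (2 * n)) : ℕ) := by
    by_contra h
    exact Nat.find_min hex hj ⟨by omega, h⟩
  set i := Nat.find hex
  obtain ⟨m, hm⟩ := w.surjective ⟨2 * n - 1 - (w ⟨i, by omega⟩ : Fin (2 * n)), by omega⟩
  have hmv := congrArg Fin.val hm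
  simp only at hmv
  have inj {a b : ℕ} {ha : a < 2 * n} {hb : b < 2 * n}
      (h : ((w ⟨a, ha⟩ : Fin (2 * n)) : ℕ) = (w ⟨b, hb⟩ : Fin (2 * n))) : a = b :=
    congrArg Fin.val (w.injective (Fin.ext h))
  have hmi : (m : ℕ) ≠ i := by
    intro h
    have : m = ⟨i, by omega⟩ := Fin.ext h
    rw [this] at hmv
    omega
  have hmi' : (m : ℕ) ≠ 2 * n - 1 - i := by
    intro h
    have : m = ⟨2 * n - 1 - i, by omega⟩ := Fin.ext h
    rw [this] at hmv
    exact hne hmv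
  have hsum : rhoEven n (w ⟨i, by omega⟩ : Fin (2 * n)) + rhoEven n (w m : Fin (2 * n)) = 0 := by
    rw [hmv, rhoEven_reflect (Fin.is_lt _), add_neg_cancel]
  unfold pairProdEven
  by_cases hmn : (m : ℕ) < n
  · have him : i < m := by
      by_contra h
      have h1 := hmin (j := m) (by omega)
      have h2 : 2 * n - 1 - (m : ℕ) = i := inj (ha := by omega) (hb := by omega) (by
        simp only [Fin.eta] at h1; omega)
      omega
    refine Finset.prod_eq_zero (i := (⟨i, hi⟩, ⟨m, hmn⟩)) (by simpa using him) ?_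
    exact mul_eq_zero_of_left hsum _
  · have hbar : (⟨2 * n - 1 - (2 * n - 1 - m), by omega⟩ : Fin (2 * n)) = m := Fin.ext (by
      simp only; omega)
    have him : i < 2 * n - 1 - m := by
      by_contra h
      have h1 := hmin (j := 2 * n - 1 - m) (by omega)
      rw [hbar] at h1
      have h2 : 2 * n - 1 - (m : ℕ) = i := inj (ha := by omega) (hb := by omega) (by omega)
      omega
    refine Finset.prod_eq_zero (i := (⟨i, hi⟩, ⟨2 * n - 1 - m, by omega⟩)) (by simpa using him) ?_
    refine mul_eq_zero_of_right _ ?_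
    simp only [hbar]
    exact hsum

theorem stmt2 (n : ℕ) (hn : 1 ≤ n) (w : Equiv.Perm (Fin (2 * n))) :
    (SignedEven n w ∧ Even (signChanges n w) →
      P1Even n w = (-1) ^ invEven n w * 2 ^ n *
        (∏ i : Fin n, (MvPolynomial.X i : MvPolynomial (Fin n) ℤ)) *
        ∏ p ∈ Finset.univ.filter (fun p : Fin n × Fin n => p.1 < p.2),
          (MvPolynomial.X p.1 + MvPolynomial.X p.2) *
            (MvPolynomial.X p.1 - MvPolynomial.X p.2)) ∧
    (¬ (SignedEven n w ∧ Even (signChanges n w)) → P1Even n w = 0) := by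
  constructor
  · rintro ⟨hs, he⟩
    obtain ⟨m, rfl⟩ := Nat.exists_eq_add_of_le' hn
    rw [P1Even, hs.prod_rhoEven, hs.pairProdEven_eq, he.neg_one_pow, Nat.add_sub_cancel]
    ring
  · intro h
    by_cases hs : SignedEven n w
    · have ho : Odd (signChanges n w) := Nat.not_even_iff_odd.mp fun he => h ⟨hs, he⟩
      rw [P1Even, hs.prod_rhoEven, ho.neg_one_pow]
      ring
    · rw [P1Even, pairProdEven_eq_zero hs, mul_zero]
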